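/- Consider a scaling satisfying the scaling condition Λ_m(n) = c_n (log n)/n with lim_{n→∞} c_n = c, where 0 < c < 1. Assume that either (a) lim_{n→∞} α_{md}(n) log n = 0, or (b) α_{md}(n) log n converges (in [0,∞]) to some α* ∈ (0,∞] and α_{mm}(n) log n converges (in [0,∞]) to some α** ∈ (0,∞]. Then the probability that the random graph H(n; μ, Θ_n) has no isolated nodes tends to 0 as n → ∞. -/

import Mathlib

open MeasureTheory Finset Filter

/-- Edge probability between a class-`i` node and a class-`j` node in the
inhomogeneous random key graph. -/
noncomputable def pEdge (P : ℕ) {r : ℕ} (K : Fin r → ℕ) (i j : Fin r) : ℝ :=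
  if K i + K j ≤ P then
    1 - ((P - K i).choose (K j) : ℝ) / (P.choose (K j) : ℝ)
  else 1

/-- Mean edge probability `Λ_i` of a class-`i` node in the intersection model. -/
noncomputable def LamE {r : ℕ} (μ : Fin r → ℝ) (α : Fin r → Fin r → ℝ)
    (P : ℕ) (K : Fin r → ℕ) (i : Fin r) : ℝ :=
  ∑ j, μ j * (α i j * pEdge P K i j)

/-- Minimum mean edge probability `Λ_m`. -/
noncomputable def LamMin {r : ℕ} (μ : Fin r → ℝ) (α : Fin r → Fin r → ℝ)
    (P : ℕ) (K : Fin r → ℕ) : ℝ :=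
  ⨅ i, LamE μ α P K i

/-- The random graph `H(n; μ, Θ)`: random types (distribution `μ`), random key
rings (uniform `K`-subsets of a `P`-pool, given types), and random channel
indicators (Bernoulli `α_{ij}`, given types), all with the joint distribution
described by the field `joint`. -/
structure HetModel (r n P : ℕ) (K : Fin r → ℕ) (μ : Fin r → ℝ)
    (α : Fin r → Fin r → ℝ) (Ω : Type) [MeasurableSpace Ω]
    (Pr : Measure Ω) : Type where
  typ : Ω → Fin n → Fin r
  keyring : Ω → Fin n → Finset (Fin P)
  chan : Ω → Fin n → Fin n → Bool
  joint : ∀ (t₀ : Fin n → Fin r) (σ₀ : Fin n → Finset (Fin P))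
      (b₀ : Fin n → Fin n → Bool),
      Pr {ω | typ ω = t₀ ∧ keyring ω = σ₀ ∧
              ∀ x y : Fin n, x < y → chan ω x y = b₀ x y}
        = ENNReal.ofReal
            ((∏ x, μ (t₀ x)) *
             (∏ x, if (σ₀ x).card = K (t₀ x)
                   then ((P.choose (K (t₀ x)) : ℝ))⁻¹ else 0) *
             (∏ x : Fin n, ∏ y ∈ univ.filter (fun y => x < y),
                (if b₀ x y then α (t₀ x) (t₀ y) else 1 - α (t₀ x) (t₀ y))))

variable {r n P : ℕ} {K : Fin r → ℕ} {μ : Fin r → ℝ} {α : Fin r → Fin r → ℝ}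
  {Ω : Type} [MeasurableSpace Ω] {Pr : Measure Ω}

/-- Adjacency in `H(n; μ, Θ)`: distinct vertices sharing a key whose channel is on. -/
def HetModel.Adj (M : HetModel r n P K μ α Ω Pr) (ω : Ω) (x y : Fin n) : Prop :=
  x ≠ y ∧ ((M.keyring ω x) ∩ (M.keyring ω y)).Nonempty ∧
    (if x < y then M.chan ω x y else M.chan ω y x) = true

/-- A vertex is isolated if it is adjacent to no other vertex. -/
def HetModel.Isolated (M : HetModel r n P K μ α Ω Pr) (ω : Ω) (x : Fin n) : Prop :=
  ∀ y : Fin n, ¬ M.Adj ω x y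

/-- Chebyshev's inequality for a count of equiprobable events on a finite weighted space. -/
lemma sum_none_le_of_second_moment {C V : Type*} [Fintype C] [Fintype V] (W : C → ℝ)
    (hW : ∀ ω, 0 ≤ W ω) (hW1 : ∑ ω, W ω = 1) (X : V → C → Prop) [∀ x ω, Decidable (X x ω)]
    [∀ ω, Decidable (∀ x, ¬ X x ω)]
    {p q : ℝ} (hp : 0 < p) (hq : 0 ≤ q) (hV : 0 < Fintype.card V)
    (h1 : ∀ x, ∑ ω, W ω * (if X x ω then 1 else 0) = p)
    (h2 : ∀ x y, x ≠ y → ∑ ω, W ω * (if X x ω ∧ X y ω then 1 else 0) ≤ q) :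
    ∑ ω, W ω * (if ∀ x, ¬ X x ω then 1 else 0)
      ≤ 1 / (Fintype.card V * p) + q / p ^ 2 - 1 := by
  classical
  set n : ℝ := (Fintype.card V : ℝ) with hn
  have hn0 : 0 < n := by rw [hn]; exact_mod_cast hV
  set N : C → ℝ := fun ω => ∑ x, if X x ω then 1 else 0 with hN
  have hEN : ∑ ω, W ω * N ω = n * p := by
    simp only [hN, mul_sum]
    rw [sum_comm, sum_congr rfl fun x _ => h1 x]
    simp [hn]
  have hEN2 : ∑ ω, W ω * N ω ^ 2 ≤ n * p + n ^ 2 * q := by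
    have hsq : ∀ ω, W ω * N ω ^ 2
        = ∑ x, ∑ y, W ω * (if X x ω ∧ X y ω then 1 else 0) := by
      intro ω
      rw [hN, sq, sum_mul_sum, mul_sum]
      refine sum_congr rfl fun x _ => ?_
      rw [mul_sum]
      refine sum_congr rfl fun y _ => ?_
      by_cases hx : X x ω <;> by_cases hy : X y ω <;> simp [hx, hy]
    calc ∑ ω, W ω * N ω ^ 2
        = ∑ x, ∑ y, ∑ ω, W ω * (if X x ω ∧ X y ω then 1 else 0) := by
          simp only [hsq]
          rw [sum_comm]
          exact sum_congr rfl fun x _ => sum_comm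
      _ ≤ ∑ x : V, ∑ y : V, ((if x = y then p else 0) + q) := by
          refine sum_le_sum fun x _ => sum_le_sum fun y _ => ?_
          by_cases hxy : x = y
          · subst hxy
            simp only [and_self, h1, if_true]
            linarith
          · simpa [hxy] using h2 x y hxy
      _ = n * p + n ^ 2 * q := by
          simp [sum_add_distrib, hn]
          ring
  have hnp : 0 < n * p := mul_pos hn0 hp
  have hcheb : ∀ ω, W ω * (if ∀ x, ¬ X x ω then 1 else 0)
      ≤ (W ω * N ω ^ 2 - 2 * (n * p) * (W ω * N ω) + (n * p) ^ 2 * W ω) / (n * p) ^ 2 := by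
    intro ω
    rw [le_div_iff₀ (by positivity)]
    by_cases hX : ∀ x, ¬ X x ω
    · have hN0 : N ω = 0 := by simp [hN, hX]
      rw [if_pos hX, hN0]
      apply le_of_eq
      ring
    · rw [if_neg hX]
      have := mul_nonneg (hW ω) (sq_nonneg (N ω - n * p))
      linarith
  calc ∑ ω, W ω * (if ∀ x, ¬ X x ω then 1 else 0)
      ≤ ∑ ω, (W ω * N ω ^ 2 - 2 * (n * p) * (W ω * N ω) + (n * p) ^ 2 * W ω) / (n * p) ^ 2 :=
        sum_le_sum fun ω _ => hcheb ω
    _ = (∑ ω, W ω * N ω ^ 2 - 2 * (n * p) * (n * p) + (n * p) ^ 2) / (n * p) ^ 2 := by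
        rw [← sum_div, sum_add_distrib, sum_sub_distrib, ← mul_sum, ← mul_sum, hEN, hW1, mul_one]
    _ ≤ (n * p + n ^ 2 * q - 2 * (n * p) * (n * p) + (n * p) ^ 2) / (n * p) ^ 2 := by
        gcongr
    _ = 1 / (n * p) + q / p ^ 2 - 1 := by
        field_simp
        ring

/-- Independent Bernoulli variables: the probability that none of those indexed by `S` and marked
by `D` is on. -/
lemma sum_bernoulli_none {E : Type*} [Fintype E] [DecidableEq E] (β : E → ℝ) (S : Finset E)
    (D : E → Prop) [DecidablePred D] :
    ∑ b : E → Bool, (∏ e, if b e then β e else 1 - β e) *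
        (if ∀ e ∈ S, ¬ (D e ∧ b e = true) then 1 else 0)
      = ∏ e ∈ S, (1 - if D e then β e else 0) := by
  have h : ∀ b : E → Bool, (∏ e, if b e then β e else 1 - β e) *
        (if ∀ e ∈ S, ¬ (D e ∧ b e = true) then 1 else 0)
      = ∏ e, (if b e then β e else 1 - β e) * (if e ∈ S ∧ D e ∧ b e = true then 0 else 1) := by
    intro b
    rw [prod_mul_distrib]
    congr 1
    split_ifs with hb
    · rw [prod_eq_one]
      intro e _
      rw [if_neg]
      exact fun he => hb e he.1 he.2
    · push Not at hb
      obtain ⟨e, he⟩ := hb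
      symm
      refine prod_eq_zero (mem_univ e) ?_
      simp [he]
  simp only [h]
  rw [← Fintype.prod_sum fun e (c : Bool) =>
    (if c then β e else 1 - β e) * (if e ∈ S ∧ D e ∧ c = true then 0 else 1)]
  trans ∏ e, if e ∈ S then 1 - (if D e then β e else 0) else 1
  swap
  · rw [prod_ite_mem, univ_inter]
  refine prod_congr rfl fun e _ => ?_
  by_cases hS : e ∈ S <;> by_cases hD : D e <;> simp [hS, hD]

/-- Independent vertex states: integrating out all states except that of `u`. -/
lemma sum_states_one {V S : Type*} [Fintype V] [DecidableEq V] [Fintype S]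
    [DecidableEq S] (w : S → ℝ) (φ : S → ℝ) (h : S → S → ℝ) (u : V) :
    ∑ s : V → S, (∏ x, w (s x)) * (φ (s u) * ∏ z ∈ univ.erase u, h (s u) (s z))
      = ∑ a, w a * φ a * (∑ b, w b * h a b) ^ (Fintype.card V - 1) := by
  have key : ∀ a, w a * φ a * (∑ b, w b * h a b) ^ (Fintype.card V - 1)
      = ∑ s : V → S, ∏ x, (if x = u then (if s x = a then w a * φ a else 0)
          else w (s x) * h a (s x)) := by
    intro a
    rw [← Fintype.prod_sum fun x (c : S) =>
      if x = u then (if c = a then w a * φ a else 0) else w c * h a c]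
    rw [← mul_prod_erase _ _ (mem_univ u)]
    congr 1
    · simp
    · rw [prod_congr rfl (g := fun _ => ∑ b, w b * h a b)]
      · simp [prod_const, card_erase_of_mem]
      · intro x hx
        simp [ne_of_mem_erase hx]
  simp only [key]
  rw [sum_comm]
  refine sum_congr rfl fun s _ => ?_
  rw [sum_eq_single (s u)]
  · rw [← mul_prod_erase _ _ (mem_univ u), ← mul_prod_erase _ _ (mem_univ u)]
    have hz : ∀ z ∈ univ.erase u, (if z = u then (if s z = s u then w (s u) * φ (s u) else 0)
        else w (s z) * h (s u) (s z)) = w (s z) * h (s u) (s z) := fun z hz =>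
      if_neg (ne_of_mem_erase hz)
    rw [prod_congr rfl hz, prod_mul_distrib, if_pos rfl, if_pos rfl]
    ring
  · intro a _ ha
    exact prod_eq_zero (mem_univ u) (by simp [ha.symm])
  · simp

/-- Independent vertex states: integrating out all states except those of `u` and `v`. -/
lemma sum_states_two {V S : Type*} [Fintype V] [DecidableEq V] [Fintype S]
    [DecidableEq S] (w : S → ℝ) (φ : S → S → ℝ) (k : S → S → S → ℝ) {u v : V} (huv : u ≠ v) :
    ∑ s : V → S, (∏ x, w (s x)) *
        (φ (s u) (s v) * ∏ z ∈ (univ.erase u).erase v, k (s u) (s v) (s z))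
      = ∑ a, ∑ a', w a * w a' * φ a a' * (∑ b, w b * k a a' b) ^ (Fintype.card V - 2) := by
  have hv : v ∈ univ.erase u := mem_erase.2 ⟨huv.symm, mem_univ v⟩
  have key : ∀ a a', w a * w a' * φ a a' * (∑ b, w b * k a a' b) ^ (Fintype.card V - 2)
      = ∑ s : V → S, ∏ x, (if x = u then (if s x = a then w a else 0)
          else if x = v then (if s x = a' then w a' * φ a a' else 0)
          else w (s x) * k a a' (s x)) := by
    intro a a'
    rw [← Fintype.prod_sum fun x (c : S) =>
      if x = u then (if c = a then w a else 0)
          else if x = v then (if c = a' then w a' * φ a a' else 0) else w c * k a a' c]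
    rw [← mul_prod_erase _ _ (mem_univ u), ← mul_prod_erase _ _ hv, ← mul_assoc]
    congr 1
    · simp [huv.symm, mul_assoc]
    · rw [prod_congr rfl (g := fun _ => ∑ b, w b * k a a' b)]
      · rw [prod_const, card_erase_of_mem hv, card_erase_of_mem (mem_univ u), card_univ]
        rfl
      · intro x hx
        rw [mem_erase, mem_erase] at hx
        simp [hx.1, hx.2.1]
  simp only [key]
  rw [sum_congr rfl fun a _ => sum_comm, sum_comm]
  refine sum_congr rfl fun s _ => ?_
  rw [sum_eq_single (s u), sum_eq_single (s v)]
  · rw [← mul_prod_erase _ _ (mem_univ u), ← mul_prod_erase _ _ hv,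
      ← mul_prod_erase _ _ (mem_univ u), ← mul_prod_erase _ _ hv]
    have hz : ∀ z ∈ (univ.erase u).erase v, (if z = u then (if s z = s u then w (s u) else 0)
        else if z = v then (if s z = s v then w (s v) * φ (s u) (s v) else 0)
        else w (s z) * k (s u) (s v) (s z)) = w (s z) * k (s u) (s v) (s z) := by
      intro z hz
      rw [mem_erase, mem_erase] at hz
      rw [if_neg hz.2.1, if_neg hz.1]
    rw [prod_congr rfl hz, prod_mul_distrib, if_pos rfl, if_pos rfl, if_neg huv.symm, if_pos rfl,
      if_pos rfl]
    ring
  · intro a _ ha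
    exact prod_eq_zero (mem_univ v) (by simp [ha.symm, huv.symm])
  · simp
  · intro a _ ha
    exact sum_eq_zero fun a' _ => prod_eq_zero (mem_univ u) (by simp [ha.symm])
  · simp

/-- The probability that a uniformly random `k`-subset of `Fin P` equals `σ`. -/
noncomputable def ringProb (P k : ℕ) (σ : Finset (Fin P)) : ℝ :=
  if σ.card = k then ((P.choose k : ℝ))⁻¹ else 0

/-- The indicator that two key rings share a key. -/
noncomputable def meets {P : ℕ} (T σ : Finset (Fin P)) : ℝ :=
  if (T ∩ σ).Nonempty then 1 else 0

/-- The probability that a vertex has a given type and key ring. -/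
noncomputable def stateProb (P : ℕ) {r : ℕ} (K : Fin r → ℕ) (μ : Fin r → ℝ)
    (a : Fin r × Finset (Fin P)) : ℝ :=
  μ a.1 * ringProb P (K a.1) a.2

/-- The probability that two vertices with given types and key rings are not adjacent. -/
noncomputable def nonadjProb {P r : ℕ} (α : Fin r → Fin r → ℝ) (a b : Fin r × Finset (Fin P)) : ℝ :=
  1 - α a.1 b.1 * meets a.2 b.2

section KeyRings

variable {P k r : ℕ}

lemma meets_nonneg (T σ : Finset (Fin P)) : 0 ≤ meets T σ := by
  unfold meets; split_ifs <;> norm_num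

lemma meets_le_one (T σ : Finset (Fin P)) : meets T σ ≤ 1 := by
  unfold meets; split_ifs <;> norm_num

lemma ringProb_nonneg (σ : Finset (Fin P)) : 0 ≤ ringProb P k σ := by
  unfold ringProb; split_ifs <;> positivity

lemma sum_ringProb_avoid (T : Finset (Fin P)) :
    ∑ σ, ringProb P k σ * (1 - meets T σ) = ((P - T.card).choose k : ℝ) / (P.choose k : ℝ) := by
  have h : ∀ σ : Finset (Fin P), ringProb P k σ * (1 - meets T σ)
      = if σ ∈ powersetCard k Tᶜ then ((P.choose k : ℝ))⁻¹ else 0 := by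
    intro σ
    have hsub : σ ⊆ Tᶜ ↔ ¬ (T ∩ σ).Nonempty := by
      rw [subset_compl_iff_disjoint_left, disjoint_iff_inter_eq_empty, not_nonempty_iff_eq_empty]
    simp only [mem_powersetCard, hsub, ringProb, meets]
    by_cases hc : σ.card = k <;> by_cases hT : (T ∩ σ).Nonempty <;> simp [hc, hT]
  rw [sum_congr rfl fun σ _ => h σ, sum_ite_mem, univ_inter, sum_const, card_powersetCard,
    card_compl, Fintype.card_fin, nsmul_eq_mul, div_eq_mul_inv]

lemma sum_ringProb (hk : k ≤ P) : ∑ σ, ringProb P k σ = 1 := by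
  have h := sum_ringProb_avoid (k := k) (∅ : Finset (Fin P))
  have hC : (P.choose k : ℝ) ≠ 0 := by exact_mod_cast (Nat.choose_pos hk).ne'
  simpa [meets, hC] using h

lemma choose_mul_choose_le_sq (a L d : ℕ) :
    a.choose L * (a + 2 * d).choose L ≤ (a + d).choose L ^ 2 := by
  have h : a.descFactorial L * (a + 2 * d).descFactorial L ≤ (a + d).descFactorial L ^ 2 := by
    rw [Nat.descFactorial_eq_prod_range, Nat.descFactorial_eq_prod_range,
      Nat.descFactorial_eq_prod_range, ← prod_mul_distrib, ← prod_pow]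
    refine prod_le_prod' fun i _ => ?_
    rcases le_total a i with hi | hi
    · simp [Nat.sub_eq_zero_of_le hi]
    · obtain ⟨e, rfl⟩ := Nat.exists_eq_add_of_le hi
      have h1 : i + e - i = e := by omega
      have h2 : i + e + 2 * d - i = e + 2 * d := by omega
      have h3 : i + e + d - i = e + d := by omega
      rw [h1, h2, h3]
      nlinarith
  simp only [Nat.descFactorial_eq_factorial_mul_choose] at h
  have hf : 0 < L.factorial ^ 2 := by positivity
  refine Nat.le_of_mul_le_mul_left ?_ hf
  nlinarith

variable {K : Fin r → ℕ} {μ : Fin r → ℝ} {α : Fin r → Fin r → ℝ}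

lemma pEdge_eq (hKP : ∀ i, 2 * K i ≤ P) (i j : Fin r) :
    pEdge P K i j = 1 - ((P - K i).choose (K j) : ℝ) / (P.choose (K j) : ℝ) := by
  have h : K i + K j ≤ P := by
    have := hKP i
    have := hKP j
    omega
  rw [pEdge, if_pos h]

lemma sum_ringProb_meets (hKP : ∀ i, 2 * K i ≤ P) (i j : Fin r) {T : Finset (Fin P)}
    (hT : T.card = K i) : ∑ σ, ringProb P (K j) σ * meets T σ = pEdge P K i j := by
  have hj : K j ≤ P := by
    have := hKP j
    omega
  have h := sum_ringProb_avoid (k := K j) T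
  simp only [mul_sub, mul_one, sum_sub_distrib, sum_ringProb hj] at h
  rw [pEdge_eq hKP, ← hT]
  linarith

lemma sum_ringProb_meets_mul_le (hKP : ∀ i, 2 * K i ≤ P) (i j : Fin r) {T : Finset (Fin P)}
    (hT : T.card = K i) (T' : Finset (Fin P)) :
    ∑ σ, ringProb P (K j) σ * (meets T σ * meets T' σ) ≤ pEdge P K i j := by
  rw [← sum_ringProb_meets hKP i j hT]
  exact sum_le_sum fun σ _ => mul_le_mul_of_nonneg_left
    (mul_le_of_le_one_right (meets_nonneg _ _) (meets_le_one _ _)) (ringProb_nonneg _)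

/-- Negative correlation: meeting two disjoint key rings of the same size. -/
lemma sum_ringProb_meets_mul_le_sq (hKP : ∀ i, 2 * K i ≤ P) (i j : Fin r) {T T' : Finset (Fin P)}
    (hT : T.card = K i) (hT' : T'.card = K i) (hd : T ∩ T' = ∅) :
    ∑ σ, ringProb P (K j) σ * (meets T σ * meets T' σ) ≤ pEdge P K i j ^ 2 := by
  have hj : K j ≤ P := by
    have := hKP j
    omega
  have hi := hKP i
  have hunion : ∀ σ, (1 - meets (T ∪ T') σ) = 1 - meets T σ - meets T' σ + meets T σ * meets T' σ := by
    intro σ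
    have : ((T ∪ T') ∩ σ).Nonempty ↔ (T ∩ σ).Nonempty ∨ (T' ∩ σ).Nonempty := by
      rw [union_inter_distrib_right, union_nonempty]
    unfold meets
    by_cases h1 : (T ∩ σ).Nonempty <;> by_cases h2 : (T' ∩ σ).Nonempty <;> simp [this, h1, h2]
  have h := sum_ringProb_avoid (k := K j) (T ∪ T')
  simp only [hunion, mul_sub, mul_add, mul_one, sum_sub_distrib, sum_add_distrib, sum_ringProb hj,
    sum_ringProb_meets hKP i j hT, sum_ringProb_meets hKP i j hT'] at h
  have hcard : (T ∪ T').card = 2 * K i := by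
    rw [card_union_of_disjoint (disjoint_iff_inter_eq_empty.2 hd), hT, hT']
    omega
  have hlc := choose_mul_choose_le_sq (P - 2 * K i) (K j) (K i)
  rw [show P - 2 * K i + 2 * K i = P by omega, show P - 2 * K i + K i = P - K i by omega] at hlc
  have hlc' : ((P - 2 * K i).choose (K j) : ℝ) * P.choose (K j) ≤ ((P - K i).choose (K j) : ℝ) ^ 2 := by
    exact_mod_cast hlc
  have hC : (0 : ℝ) < P.choose (K j) := by exact_mod_cast Nat.choose_pos hj
  have hle : ((P - 2 * K i).choose (K j) : ℝ) / P.choose (K j)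
      ≤ (((P - K i).choose (K j) : ℝ) / P.choose (K j)) ^ 2 := by
    rw [div_pow, div_le_div_iff₀ hC (by positivity)]
    nlinarith
  rw [hcard] at h
  have hp := pEdge_eq hKP i j
  rw [show ((P - K i).choose (K j) : ℝ) / P.choose (K j) = 1 - pEdge P K i j by linarith] at hle
  nlinarith

lemma pEdge_nonneg (hKP : ∀ i, 2 * K i ≤ P) (i j : Fin r) : 0 ≤ pEdge P K i j := by
  have hj : K j ≤ P := by
    have := hKP j
    omega
  rw [pEdge_eq hKP, sub_nonneg]
  refine div_le_one_of_le₀ ?_ (by positivity)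
  exact_mod_cast Nat.choose_le_choose _ (Nat.sub_le _ _)

lemma sum_stateProb (hKP : ∀ i, 2 * K i ≤ P) (hμ : ∑ i, μ i = 1) :
    ∑ a, stateProb P K μ a = 1 := by
  rw [Fintype.sum_prod_type, ← hμ]
  refine sum_congr rfl fun j _ => ?_
  have hj : K j ≤ P := by
    have := hKP j
    omega
  simp only [stateProb]
  rw [← mul_sum, sum_ringProb hj, mul_one]

lemma stateProb_nonneg (hμ : ∀ i, 0 < μ i) (a : Fin r × Finset (Fin P)) :
    0 ≤ stateProb P K μ a :=
  mul_nonneg (hμ _).le (ringProb_nonneg _)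

lemma card_of_stateProb_ne_zero {a : Fin r × Finset (Fin P)} (h : stateProb P K μ a ≠ 0) :
    a.2.card = K a.1 := by
  by_contra hc
  exact h (by simp [stateProb, ringProb, hc])

lemma nonadjProb_nonneg (hα1 : ∀ i j, α i j < 1)
    (a b : Fin r × Finset (Fin P)) : 0 ≤ nonadjProb α a b := by
  have := mul_le_mul (hα1 a.1 b.1).le (meets_le_one a.2 b.2) (meets_nonneg _ _) zero_le_one
  rw [nonadjProb]
  linarith

lemma sum_stateProb_nonadj (hKP : ∀ i, 2 * K i ≤ P) (hμ : ∑ i, μ i = 1)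
    {a : Fin r × Finset (Fin P)} (ha : a.2.card = K a.1) :
    ∑ b, stateProb P K μ b * nonadjProb α a b = 1 - LamE μ α P K a.1 := by
  have h : ∀ b : Fin r × Finset (Fin P), stateProb P K μ b * nonadjProb α a b
      = stateProb P K μ b - μ b.1 * (α a.1 b.1 * (ringProb P (K b.1) b.2 * meets a.2 b.2)) := by
    intro b
    rw [nonadjProb, stateProb]
    ring
  rw [sum_congr rfl fun b _ => h b, sum_sub_distrib, sum_stateProb hKP hμ, Fintype.sum_prod_type,
    LamE]
  simp only [← mul_sum, sum_ringProb_meets hKP a.1 _ ha]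

lemma sum_stateProb_nonadj_mul (hKP : ∀ i, 2 * K i ≤ P) (hμ : ∑ i, μ i = 1) {i : Fin r}
    {T T' : Finset (Fin P)} (hT : T.card = K i) (hT' : T'.card = K i) :
    ∑ b, stateProb P K μ b * (nonadjProb α (i, T) b * nonadjProb α (i, T') b)
      = 1 - 2 * LamE μ α P K i
        + ∑ j, μ j * (α i j ^ 2 * ∑ σ, ringProb P (K j) σ * (meets T σ * meets T' σ)) := by
  have h : ∀ b : Fin r × Finset (Fin P),
      stateProb P K μ b * (nonadjProb α (i, T) b * nonadjProb α (i, T') b)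
      = stateProb P K μ b * nonadjProb α (i, T) b + stateProb P K μ b * nonadjProb α (i, T') b
        - stateProb P K μ b
        + μ b.1 * (α i b.1 ^ 2 * (ringProb P (K b.1) b.2 * (meets T b.2 * meets T' b.2))) := by
    intro b
    simp only [nonadjProb, stateProb]
    ring
  rw [sum_congr rfl fun b _ => h b, sum_add_distrib, sum_sub_distrib, sum_add_distrib,
    sum_stateProb_nonadj hKP hμ hT, sum_stateProb_nonadj hKP hμ hT', sum_stateProb hKP hμ,
    Fintype.sum_prod_type]
  simp only [← mul_sum]
  ring

lemma LamE_nonneg (hKP : ∀ i, 2 * K i ≤ P) (hμ : ∀ i, 0 < μ i) (hα0 : ∀ i j, 0 < α i j)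
    (i : Fin r) : 0 ≤ LamE μ α P K i :=
  sum_nonneg fun j _ => mul_nonneg (hμ j).le (mul_nonneg (hα0 i j).le (pEdge_nonneg hKP i j))

lemma mul_pEdge_le_LamE (hKP : ∀ i, 2 * K i ≤ P) (hμ : ∀ i, 0 < μ i) (hα0 : ∀ i j, 0 < α i j)
    (i j : Fin r) : μ j * (α i j * pEdge P K i j) ≤ LamE μ α P K i :=
  single_le_sum (f := fun j => μ j * (α i j * pEdge P K i j))
    (fun j _ => mul_nonneg (hμ j).le (mul_nonneg (hα0 i j).le (pEdge_nonneg hKP i j)))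
    (mem_univ j)

lemma sum_stateProb_nonadj_mul_le (hKP : ∀ i, 2 * K i ≤ P) (hμ : ∑ i, μ i = 1)
    (hμ0 : ∀ i, 0 < μ i) (hα0 : ∀ i j, 0 < α i j) {i : Fin r} {A : ℝ} (hA : ∀ j, α i j ≤ A)
    {T T' : Finset (Fin P)} (hT : T.card = K i) (hT' : T'.card = K i) :
    ∑ b, stateProb P K μ b * (nonadjProb α (i, T) b * nonadjProb α (i, T') b)
      ≤ 1 - 2 * LamE μ α P K i + A * LamE μ α P K i := by
  rw [sum_stateProb_nonadj_mul hKP hμ hT hT']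
  gcongr
  rw [LamE, mul_sum]
  refine sum_le_sum fun j _ => ?_
  calc μ j * (α i j ^ 2 * ∑ σ, ringProb P (K j) σ * (meets T σ * meets T' σ))
      ≤ μ j * (α i j * A * pEdge P K i j) := by
        have := sum_ringProb_meets_mul_le hKP i j hT T'
        have h0 := pEdge_nonneg hKP i j
        have hμj := hμ0 j
        have hαj := hα0 i j
        have hsq : α i j ^ 2 ≤ α i j * A := by
          rw [sq]
          exact mul_le_mul_of_nonneg_left (hA j) hαj.le
        refine mul_le_mul_of_nonneg_left ?_ hμj.le
        exact (mul_le_mul_of_nonneg_left this (sq_nonneg _)).trans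
          (mul_le_mul_of_nonneg_right hsq h0)
    _ = A * (μ j * (α i j * pEdge P K i j)) := by ring

lemma sum_stateProb_nonadj_mul_le_of_disjoint (hKP : ∀ i, 2 * K i ≤ P) (hμ : ∑ i, μ i = 1)
    (hμ0 : ∀ i, 0 < μ i) (hα0 : ∀ i j, 0 < α i j) {i : Fin r}
    {T T' : Finset (Fin P)} (hT : T.card = K i) (hT' : T'.card = K i) (hd : T ∩ T' = ∅) :
    ∑ b, stateProb P K μ b * (nonadjProb α (i, T) b * nonadjProb α (i, T') b)
      ≤ 1 - 2 * LamE μ α P K i + (∑ j, (μ j)⁻¹) * LamE μ α P K i ^ 2 := by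
  rw [sum_stateProb_nonadj_mul hKP hμ hT hT', sum_mul]
  refine (add_le_add_iff_left _).2 (sum_le_sum fun j _ => ?_)
  have hμj := hμ0 j
  calc μ j * (α i j ^ 2 * ∑ σ, ringProb P (K j) σ * (meets T σ * meets T' σ))
      ≤ μ j * (α i j ^ 2 * pEdge P K i j ^ 2) := by
        have := sum_ringProb_meets_mul_le_sq hKP i j hT hT' hd
        gcongr
    _ = (μ j)⁻¹ * (μ j * (α i j * pEdge P K i j)) ^ 2 := by
        field_simp
    _ ≤ (μ j)⁻¹ * LamE μ α P K i ^ 2 := by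
        have := mul_pEdge_le_LamE hKP hμ0 hα0 i j
        have h0 := pEdge_nonneg hKP i j
        have hαj := hα0 i j
        gcongr

end KeyRings

section Configurations

variable {n P r : ℕ} {K : Fin r → ℕ} {μ : Fin r → ℝ} {α : Fin r → Fin r → ℝ}

/-- The ordered pair representing the unordered pair of `x` and `y`. -/
def edgeOf (x y : Fin n) : Fin n × Fin n := if x < y then (x, y) else (y, x)

/-- A configuration: the states (type and key ring) of all vertices, and the channels. -/
abbrev Config (n r P : ℕ) : Type :=
  (Fin n → Fin r × Finset (Fin P)) × (Fin n × Fin n → Bool)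

/-- The probability that the channel `e` is on; channels `(x, y)` with `y ≤ x` are always off. -/
noncomputable def chanProb (α : Fin r → Fin r → ℝ) (s : Fin n → Fin r × Finset (Fin P))
    (e : Fin n × Fin n) : ℝ :=
  if e.1 < e.2 then α (s e.1).1 (s e.2).1 else 0

/-- The probability of a configuration. -/
noncomputable def configProb (K : Fin r → ℕ) (μ : Fin r → ℝ) (α : Fin r → Fin r → ℝ)
    (ω : Config n r P) : ℝ :=
  (∏ x, stateProb P K μ (ω.1 x)) *
    ∏ e, if ω.2 e then chanProb α ω.1 e else 1 - chanProb α ω.1 e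

/-- In the configuration `ω`, the vertex `x` has type `i` and is isolated. -/
def IsolatedOfType (i : Fin r) (x : Fin n) (ω : Config n r P) : Prop :=
  (ω.1 x).1 = i ∧
    ∀ y ∈ univ.erase x, ¬ (((ω.1 x).2 ∩ (ω.1 y).2).Nonempty ∧ ω.2 (edgeOf x y) = true)

instance (i : Fin r) (x : Fin n) (ω : Config n r P) : Decidable (IsolatedOfType i x ω) := by
  unfold IsolatedOfType; infer_instance

lemma edgeOf_inter (s : Fin n → Fin r × Finset (Fin P)) (x y : Fin n) :
    ((s (edgeOf x y).1).2 ∩ (s (edgeOf x y).2).2).Nonempty ↔ ((s x).2 ∩ (s y).2).Nonempty := by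
  unfold edgeOf
  split_ifs
  · rfl
  · rw [inter_comm]

lemma chanProb_edgeOf (hα : ∀ i j, α i j = α j i) (s : Fin n → Fin r × Finset (Fin P))
    {x y : Fin n} (hxy : x ≠ y) : chanProb α s (edgeOf x y) = α (s x).1 (s y).1 := by
  unfold edgeOf chanProb
  split_ifs with h1 h2
  · rfl
  · exact hα _ _
  · exact absurd (lt_of_le_of_ne (not_lt.1 h1) hxy.symm) ‹_›

lemma edgeOf_eq_iff {x y u v : Fin n} :
    edgeOf x y = edgeOf u v ↔ (x = u ∧ y = v) ∨ (x = v ∧ y = u) := by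
  unfold edgeOf
  split_ifs <;> simp only [Prod.mk.injEq] <;> omega

lemma one_sub_chanProb_edgeOf (hα : ∀ i j, α i j = α j i) (s : Fin n → Fin r × Finset (Fin P))
    {x y : Fin n} (hxy : x ≠ y) :
    (1 - if ((s (edgeOf x y).1).2 ∩ (s (edgeOf x y).2).2).Nonempty
      then chanProb α s (edgeOf x y) else 0) = nonadjProb α (s x) (s y) := by
  simp only [edgeOf_inter, chanProb_edgeOf hα s hxy, nonadjProb, meets, mul_ite, mul_one, mul_zero]

lemma configProb_nonneg (hμ : ∀ i, 0 < μ i) (hα0 : ∀ i j, 0 < α i j) (hα1 : ∀ i j, α i j < 1)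
    (ω : Config n r P) : 0 ≤ configProb K μ α ω := by
  refine mul_nonneg (prod_nonneg fun x _ => stateProb_nonneg hμ _) (prod_nonneg fun e _ => ?_)
  have h0 : 0 ≤ chanProb α ω.1 e := by
    unfold chanProb; split_ifs
    exacts [(hα0 _ _).le, le_rfl]
  have h1 : chanProb α ω.1 e ≤ 1 := by
    unfold chanProb; split_ifs
    exacts [(hα1 _ _).le, zero_le_one]
  split_ifs
  · exact h0
  · exact sub_nonneg.2 h1

lemma sum_configProb_none (s : Fin n → Fin r × Finset (Fin P)) (S : Finset (Fin n × Fin n)) :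
    ∑ b : Fin n × Fin n → Bool, configProb K μ α (s, b) *
        (if ∀ e ∈ S, ¬ (((s e.1).2 ∩ (s e.2).2).Nonempty ∧ b e = true) then 1 else 0)
      = (∏ x, stateProb P K μ (s x)) *
        ∏ e ∈ S, (1 - if ((s e.1).2 ∩ (s e.2).2).Nonempty then chanProb α s e else 0) := by
  rw [← sum_bernoulli_none, mul_sum]
  exact sum_congr rfl fun b _ => mul_assoc _ _ _

lemma sum_configProb (hKP : ∀ i, 2 * K i ≤ P) (hμ : ∑ i, μ i = 1) :
    ∑ ω : Config n r P, configProb K μ α ω = 1 := by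
  rw [Fintype.sum_prod_type]
  have h : ∀ s : Fin n → Fin r × Finset (Fin P),
      ∑ b, configProb K μ α (s, b) = ∏ x, stateProb P K μ (s x) := by
    intro s
    simpa using sum_configProb_none (K := K) (μ := μ) (α := α) s ∅
  rw [sum_congr rfl fun s _ => h s, ← Fintype.prod_sum fun (_ : Fin n) a => stateProb P K μ a]
  simp [sum_stateProb hKP hμ]

lemma sum_configProb_isolatedOfType (hKP : ∀ i, 2 * K i ≤ P) (hμ : ∑ i, μ i = 1)
    (hα : ∀ i j, α i j = α j i) (i : Fin r) (x : Fin n) :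
    ∑ ω : Config n r P, configProb K μ α ω * (if IsolatedOfType i x ω then 1 else 0)
      = μ i * (1 - LamE μ α P K i) ^ (n - 1) := by
  have hinner : ∀ s : Fin n → Fin r × Finset (Fin P),
      ∑ b, configProb K μ α (s, b) * (if IsolatedOfType i x (s, b) then 1 else 0)
      = (∏ z, stateProb P K μ (s z)) *
        ((if (s x).1 = i then 1 else 0) * ∏ z ∈ univ.erase x, nonadjProb α (s x) (s z)) := by
    intro s
    have hprod : ∏ e ∈ (univ.erase x).image (edgeOf x),
        (1 - if ((s e.1).2 ∩ (s e.2).2).Nonempty then chanProb α s e else 0)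
        = ∏ z ∈ univ.erase x, nonadjProb α (s x) (s z) := by
      rw [prod_image]
      · exact prod_congr rfl fun z hz =>
          one_sub_chanProb_edgeOf hα s (ne_of_mem_erase hz).symm
      · intro y hy z hz h
        rcases edgeOf_eq_iff.1 h with h | h
        · exact h.2
        · exact h.2.trans h.1
    rw [← hprod, mul_left_comm, ← sum_configProb_none, mul_sum]
    refine sum_congr rfl fun b _ => ?_
    simp only [IsolatedOfType, forall_mem_image, edgeOf_inter, ite_and]
    by_cases h : (s x).1 = i <;> simp [h]
  have hst : ∀ a : Fin r × Finset (Fin P), stateProb P K μ a * (if a.1 = i then 1 else 0) *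
        (∑ b, stateProb P K μ b * nonadjProb α a b) ^ (n - 1)
      = (if a.1 = i then μ i else 0) * ringProb P (K i) a.2 *
        (1 - LamE μ α P K i) ^ (n - 1) := by
    intro a
    by_cases hw : stateProb P K μ a = 0
    · by_cases hi : a.1 = i
      · subst hi
        rw [stateProb] at hw
        simp [stateProb, hw]
      · simp [hi]
    · rw [sum_stateProb_nonadj hKP hμ (card_of_stateProb_ne_zero hw)]
      by_cases hi : a.1 = i
      · subst hi
        simp [stateProb]
      · simp [hi]
  have hi : K i ≤ P := by
    have := hKP i
    omega
  rw [Fintype.sum_prod_type, sum_congr rfl fun s _ => hinner s,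
    sum_states_one (stateProb P K μ) (fun a => if a.1 = i then 1 else 0) (nonadjProb α) x,
    Fintype.card_fin, sum_congr rfl fun a _ => hst a, ← sum_mul, Fintype.sum_prod_type]
  simp [← mul_sum, sum_ringProb hi]

lemma sum_configProb_isolatedOfType_pair_le (hKP : ∀ i, 2 * K i ≤ P)
    (hμ0 : ∀ i, 0 < μ i) (hα : ∀ i j, α i j = α j i)
    (hα0 : ∀ i j, 0 < α i j) (hα1 : ∀ i j, α i j < 1) {i : Fin r} {U V : ℝ}
    (hUV : ∀ T T' : Finset (Fin P), T.card = K i → T'.card = K i →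
      (∑ b, stateProb P K μ b * (nonadjProb α (i, T) b * nonadjProb α (i, T') b)) ^ (n - 2)
        ≤ U + meets T T' * V) {x y : Fin n} (hxy : x ≠ y) :
    ∑ ω : Config n r P, configProb K μ α ω *
        (if IsolatedOfType i x ω ∧ IsolatedOfType i y ω then 1 else 0)
      ≤ μ i ^ 2 * (U + pEdge P K i i * V) := by
  set R : Finset (Fin n) := (univ.erase x).erase y with hR
  have hinner : ∀ s : Fin n → Fin r × Finset (Fin P),
      ∑ b, configProb K μ α (s, b) *
        (if IsolatedOfType i x (s, b) ∧ IsolatedOfType i y (s, b) then 1 else 0)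
      ≤ (∏ z, stateProb P K μ (s z)) *
        ((if (s x).1 = i ∧ (s y).1 = i then 1 else 0) *
          ∏ z ∈ R, nonadjProb α (s x) (s z) * nonadjProb α (s y) (s z)) := by
    intro s
    have hinj : ∀ v : Fin n, Set.InjOn (edgeOf v) (R : Set (Fin n)) := by
      intro v y _ z _ h
      rcases edgeOf_eq_iff.1 h with h | h
      · exact h.2
      · exact h.2.trans h.1
    have hdisj : Disjoint (R.image (edgeOf x)) (R.image (edgeOf y)) := by
      rw [disjoint_left]
      intro e he he'
      obtain ⟨z, hz, rfl⟩ := mem_image.1 he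
      obtain ⟨z', hz', h⟩ := mem_image.1 he'
      simp only [hR, mem_erase] at hz hz'
      rcases edgeOf_eq_iff.1 h with h | h
      · exact hxy h.1.symm
      · exact hz.1 h.1.symm
    have hprod : ∏ e ∈ R.image (edgeOf x) ∪ R.image (edgeOf y),
        (1 - if ((s e.1).2 ∩ (s e.2).2).Nonempty then chanProb α s e else 0)
        = ∏ z ∈ R, nonadjProb α (s x) (s z) * nonadjProb α (s y) (s z) := by
      rw [prod_union hdisj, prod_image (hinj x), prod_image (hinj y), ← prod_mul_distrib]
      refine prod_congr rfl fun z hz => ?_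
      simp only [hR, mem_erase] at hz
      rw [one_sub_chanProb_edgeOf hα s (Ne.symm hz.2.1), one_sub_chanProb_edgeOf hα s (Ne.symm hz.1)]
    rw [← hprod, mul_left_comm, ← sum_configProb_none, mul_sum]
    refine sum_le_sum fun b _ => ?_
    rw [mul_left_comm]
    refine mul_le_mul_of_nonneg_left ?_ (configProb_nonneg hμ0 hα0 hα1 _)
    by_cases h : IsolatedOfType i x (s, b) ∧ IsolatedOfType i y (s, b)
    · rw [if_pos h, if_pos ⟨h.1.1, h.2.1⟩, if_pos, one_mul]
      intro e he
      rcases mem_union.1 he with he | he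
      · obtain ⟨z, hz, rfl⟩ := mem_image.1 he
        rw [edgeOf_inter]
        exact h.1.2 z (mem_of_mem_erase hz)
      · obtain ⟨z, hz, rfl⟩ := mem_image.1 he
        rw [edgeOf_inter]
        exact h.2.2 z (mem_erase.2 ⟨ne_of_mem_erase hz, mem_univ z⟩)
    · rw [if_neg h]
      positivity
  have hst : ∀ a a' : Fin r × Finset (Fin P), stateProb P K μ a * stateProb P K μ a' *
        (if a.1 = i ∧ a'.1 = i then 1 else 0) *
        (∑ b, stateProb P K μ b * (nonadjProb α a b * nonadjProb α a' b)) ^ (n - 2)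
      ≤ (if a.1 = i then μ i else 0) * ((if a'.1 = i then μ i else 0) *
        (ringProb P (K i) a.2 * (ringProb P (K i) a'.2 * (U + meets a.2 a'.2 * V)))) := by
    rintro ⟨j, T⟩ ⟨j', T'⟩
    by_cases hj : j = i
    swap
    · simp [hj]
    by_cases hj' : j' = i
    swap
    · simp [hj']
    subst hj hj'
    by_cases hT : T.card = K j'
    swap
    · simp [stateProb, ringProb, hT]
    by_cases hT' : T'.card = K j'
    swap
    · simp [stateProb, ringProb, hT']
    have h1 := mul_le_mul_of_nonneg_left (hUV T T' hT hT')
      (mul_nonneg (stateProb_nonneg (K := K) hμ0 (j', T)) (stateProb_nonneg (K := K) hμ0 (j', T')))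
    simp only [and_self, if_true, mul_one]
    refine h1.trans (le_of_eq ?_)
    simp only [stateProb]
    ring
  have hi : K i ≤ P := by
    have := hKP i
    omega
  have hring : ∑ σ, ∑ σ', ringProb P (K i) σ * (ringProb P (K i) σ' * (U + meets σ σ' * V))
      = U + pEdge P K i i * V := by
    have h : ∀ σ : Finset (Fin P), ∑ σ', ringProb P (K i) σ *
        (ringProb P (K i) σ' * (U + meets σ σ' * V))
        = ringProb P (K i) σ * (U + pEdge P K i i * V) := by
      intro σ
      by_cases hσ : σ.card = K i
      · rw [← mul_sum, ← sum_ringProb_meets hKP i i hσ]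
        simp only [mul_add, sum_add_distrib, ← mul_assoc, ← sum_mul, sum_ringProb hi, one_mul]
      · simp [ringProb, hσ]
    rw [sum_congr rfl fun σ _ => h σ, ← sum_mul, sum_ringProb hi, one_mul]
  rw [Fintype.sum_prod_type]
  refine (sum_le_sum fun s _ => hinner s).trans ?_
  rw [sum_states_two (stateProb P K μ) (fun a a' => if a.1 = i ∧ a'.1 = i then 1 else 0)
    (fun a a' b => nonadjProb α a b * nonadjProb α a' b) hxy, Fintype.card_fin]
  refine (sum_le_sum fun a _ => sum_le_sum fun a' _ => hst a a').trans (le_of_eq ?_)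
  rw [← hring, Fintype.sum_prod_type]
  simp only [Fintype.sum_prod_type, ← mul_sum]
  simp only [ite_mul, zero_mul, sum_ite_irrel, sum_const_zero, sum_ite_eq', mem_univ, if_true, mul_sum]
  refine sum_congr rfl fun σ _ => sum_congr rfl fun σ' _ => ?_
  ring

end Configurations

/-- The event that no vertex is isolated is covered by the configurations without isolated vertex
of a given type. -/
lemma HetModel.measure_no_isolated_le {r n P : ℕ} {K : Fin r → ℕ} {μ : Fin r → ℝ}
    {α : Fin r → Fin r → ℝ} {Ω : Type} [MeasurableSpace Ω] {Pr : Measure Ω}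
    (M : HetModel r n P K μ α Ω Pr) (hμ0 : ∀ i, 0 < μ i) (hα0 : ∀ i j, 0 < α i j)
    (hα1 : ∀ i j, α i j < 1) (i : Fin r) :
    Pr {ω | ∀ x : Fin n, ¬ M.Isolated ω x} ≤ ENNReal.ofReal
      (∑ ω : Config n r P, configProb K μ α ω *
        (if ∀ x, ¬ IsolatedOfType i x ω then 1 else 0)) := by
  set conf : Ω → Config n r P := fun ω =>
    (fun x => (M.typ ω x, M.keyring ω x), fun e => decide (e.1 < e.2) && M.chan ω e.1 e.2)
    with hconf
  have hiso : ∀ ω x, IsolatedOfType i x (conf ω) → M.Isolated ω x := by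
    rintro ω x ⟨-, h⟩ y ⟨hxy, hne, hch⟩
    refine h y (mem_erase.2 ⟨hxy.symm, mem_univ y⟩) ⟨hne, ?_⟩
    simp only [hconf, edgeOf]
    by_cases hlt : x < y
    · simpa [hlt] using hch
    · have hyx : y < x := lt_of_le_of_ne (not_lt.1 hlt) hxy.symm
      simpa [hlt, hyx] using hch
  have hmeas : ∀ c : Config n r P, Pr {ω | conf ω = c} ≤ ENNReal.ofReal (configProb K μ α c) := by
    rintro ⟨s, b⟩
    by_cases hb : ∀ e : Fin n × Fin n, ¬ e.1 < e.2 → b e = false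
    · have hsub : {ω | conf ω = (s, b)} ⊆ {ω | M.typ ω = (fun x => (s x).1) ∧
          M.keyring ω = (fun x => (s x).2) ∧ ∀ x y : Fin n, x < y → M.chan ω x y = b (x, y)} := by
        intro ω hω
        rw [Set.mem_ofPred_eq, hconf, Prod.mk.injEq] at hω
        obtain ⟨h1, h2⟩ := hω
        refine ⟨funext fun x => ?_, funext fun x => ?_, fun x y hxy => ?_⟩
        · rw [← h1]
        · rw [← h1]
        · rw [← h2]
          simp [hxy]
      refine (measure_mono hsub).trans (le_of_eq ?_)
      rw [M.joint _ _ fun x y => b (x, y)]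
      congr 1
      rw [configProb, Fintype.prod_prod_type, ← prod_mul_distrib]
      congr 1
      refine prod_congr rfl fun x _ => ?_
      rw [prod_filter]
      refine prod_congr rfl fun y _ => ?_
      by_cases hxy : x < y
      · simp [chanProb, hxy]
      · simp [chanProb, hxy, hb (x, y) hxy]
    · have hempty : {ω | conf ω = (s, b)} = ∅ := by
        rw [Set.eq_empty_iff_forall_notMem]
        intro ω hω
        apply hb
        intro e he
        rw [Set.mem_ofPred_eq, hconf, Prod.mk.injEq] at hω
        rw [← hω.2]
        simp [he]
      rw [hempty, measure_empty]
      exact zero_le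
  have hcover : {ω | ∀ x : Fin n, ¬ M.Isolated ω x}
      ⊆ ⋃ c ∈ univ.filter (fun c : Config n r P => ∀ x, ¬ IsolatedOfType i x c),
        {ω | conf ω = c} := by
    intro ω hω
    simp only [Set.mem_iUnion]
    exact ⟨conf ω, mem_filter.2 ⟨mem_univ _, fun x hx => hω x (hiso ω x hx)⟩, rfl⟩
  calc Pr {ω | ∀ x : Fin n, ¬ M.Isolated ω x}
      ≤ ∑ c ∈ univ.filter (fun c : Config n r P => ∀ x, ¬ IsolatedOfType i x c),
          Pr {ω | conf ω = c} := (measure_mono hcover).trans (measure_biUnion_finset_le _ _)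
    _ ≤ ∑ c ∈ univ.filter (fun c : Config n r P => ∀ x, ¬ IsolatedOfType i x c),
          ENNReal.ofReal (configProb K μ α c) := sum_le_sum fun c _ => hmeas c
    _ = _ := by
      rw [← ENNReal.ofReal_sum_of_nonneg fun c _ => configProb_nonneg hμ0 hα0 hα1 c, sum_filter]
      congr 1
      exact sum_congr rfl fun c _ => by simp

lemma inv_one_sub_pow_le_exp {x : ℝ} (h0 : 0 ≤ x) (h1 : x < 1) {k n : ℕ} (hk : k ≤ n) :
    ((1 - x) ^ k)⁻¹ ≤ Real.exp (n * (x / (1 - x))) := by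
  have hpos : 0 < 1 - x := by linarith
  have hinv : (1 - x)⁻¹ ≤ Real.exp (x / (1 - x)) := by
    have h := Real.add_one_le_exp (x / (1 - x))
    have : x / (1 - x) + 1 = (1 - x)⁻¹ := by
      field_simp
      ring
    linarith
  have hx : 0 ≤ x / (1 - x) := div_nonneg h0 hpos.le
  calc ((1 - x) ^ k)⁻¹ = ((1 - x)⁻¹) ^ k := (inv_pow _ _).symm
    _ ≤ (Real.exp (x / (1 - x))) ^ k := by gcongr
    _ = Real.exp (k * (x / (1 - x))) := (Real.exp_nat_mul _ _).symm
    _ ≤ Real.exp (n * (x / (1 - x))) := by gcongr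

lemma second_moment_ratio_le {x δ : ℝ} (h0 : 0 ≤ x) (h1 : x ≤ 1 / 2) (hδ : 0 ≤ δ) {n : ℕ}
    (hn : 2 ≤ n) : (1 - 2 * x + δ) ^ (n - 2) / (1 - x) ^ (2 * (n - 1))
      ≤ ((1 - x) ^ 2)⁻¹ * Real.exp (4 * (n * δ)) := by
  obtain ⟨k, rfl⟩ := Nat.exists_eq_add_of_le hn
  have hpos : 0 < 1 - x := by linarith
  rw [show 2 + k - 2 = k by omega, show 2 * (2 + k - 1) = 2 + 2 * k by omega, pow_add, pow_mul,
    ← div_div, div_right_comm, ← div_pow, div_eq_inv_mul]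
  have hratio : (1 - 2 * x + δ) / (1 - x) ^ 2 ≤ 1 + 4 * δ := by
    rw [div_le_iff₀ (by positivity)]
    have h4 : 1 / 4 ≤ (1 - x) ^ 2 := by nlinarith
    nlinarith
  have hbase : 0 ≤ (1 - 2 * x + δ) / (1 - x) ^ 2 := div_nonneg (by linarith) (by positivity)
  gcongr
  calc ((1 - 2 * x + δ) / (1 - x) ^ 2) ^ k
      ≤ (Real.exp (4 * δ)) ^ k := by
        gcongr
        linarith [Real.add_one_le_exp (4 * δ)]
    _ = Real.exp (k * (4 * δ)) := (Real.exp_nat_mul _ _).symm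
    _ ≤ Real.exp (4 * (((2 + k : ℕ) : ℝ) * δ)) := by
        rw [Real.exp_le_exp]
        push_cast
        nlinarith

/-- A quantitative second moment bound on the probability that no vertex is isolated. -/
lemma HetModel.measure_no_isolated_le_exp {r n P : ℕ} {K : Fin r → ℕ} {μ : Fin r → ℝ}
    {α : Fin r → Fin r → ℝ} {Ω : Type} [MeasurableSpace Ω] {Pr : Measure Ω}
    (M : HetModel r n P K μ α Ω Pr) (hn : 2 ≤ n) (hKP : ∀ i, 2 * K i ≤ P)
    (hμ : ∑ i, μ i = 1) (hμ0 : ∀ i, 0 < μ i) (hα : ∀ i j, α i j = α j i)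
    (hα0 : ∀ i j, 0 < α i j) (hα1 : ∀ i j, α i j < 1) {i : Fin r} {x δ q V ε : ℝ}
    (hx : LamE μ α P K i = x) (hx1 : x ≤ 1 / 2) (hδ : 0 ≤ δ) (hV : 0 ≤ V)
    (hq : pEdge P K i i * V ≤ q) (hε0 : 0 < ε) (hε : ε ≤ μ i)
    (hJ : ∀ T T' : Finset (Fin P), T.card = K i → T'.card = K i →
      (∑ b, stateProb P K μ b * (nonadjProb α (i, T) b * nonadjProb α (i, T') b)) ^ (n - 2)
        ≤ (1 - 2 * x + δ) ^ (n - 2) + meets T T' * (V * (1 - x) ^ (n - 2))) :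
    Pr {ω | ∀ x : Fin n, ¬ M.Isolated ω x} ≤ ENNReal.ofReal
      (Real.exp (n * (x / (1 - x))) / (n * ε) + ((1 - x) ^ 2)⁻¹ * Real.exp (4 * (n * δ))
        + q * Real.exp (n * (x / (1 - x))) - 1) := by
  refine (M.measure_no_isolated_le hμ0 hα0 hα1 i).trans (ENNReal.ofReal_le_ofReal ?_)
  have hx0 : 0 ≤ x := hx ▸ LamE_nonneg hKP hμ0 hα0 i
  have hpos : 0 < 1 - x := by linarith
  have hn0 : (0 : ℝ) < n := by exact_mod_cast (by omega : 0 < n)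
  have hμi := hμ0 i
  have hp0 := pEdge_nonneg hKP i i
  have hU : 0 ≤ (1 - 2 * x + δ) ^ (n - 2) := pow_nonneg (by linarith) _
  have hmain := sum_none_le_of_second_moment (V := Fin n) (configProb (P := P) K μ α)
    (configProb_nonneg hμ0 hα0 hα1) (sum_configProb hKP hμ) (IsolatedOfType i)
    (p := μ i * (1 - x) ^ (n - 1))
    (q := μ i ^ 2 * ((1 - 2 * x + δ) ^ (n - 2) + pEdge P K i i * (V * (1 - x) ^ (n - 2))))
    (by positivity) (by positivity) (by rw [Fintype.card_fin]; omega)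
    (fun v => by rw [sum_configProb_isolatedOfType hKP hμ hα, hx])
    (fun v w hvw => sum_configProb_isolatedOfType_pair_le hKP hμ0 hα hα0 hα1 hJ hvw)
  refine hmain.trans ?_
  rw [Fintype.card_fin]
  have h1 : 1 / ((n : ℝ) * (μ i * (1 - x) ^ (n - 1))) ≤ Real.exp (n * (x / (1 - x))) / (n * ε) := by
    rw [← mul_assoc, ← div_div, div_right_comm, one_div]
    have := inv_one_sub_pow_le_exp hx0 (by linarith : x < 1) (Nat.sub_le n 1)
    gcongr
  have h2 : μ i ^ 2 * ((1 - 2 * x + δ) ^ (n - 2) + pEdge P K i i * (V * (1 - x) ^ (n - 2)))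
        / (μ i * (1 - x) ^ (n - 1)) ^ 2
      = (1 - 2 * x + δ) ^ (n - 2) / (1 - x) ^ (2 * (n - 1))
        + pEdge P K i i * V * ((1 - x) ^ n)⁻¹ := by
    obtain ⟨k, rfl⟩ := Nat.exists_eq_add_of_le hn
    rw [show 2 + k - 2 = k by omega, show 2 + k - 1 = k + 1 by omega]
    field_simp
    ring
  have h3 := second_moment_ratio_le hx0 hx1 hδ hn
  have h4 : pEdge P K i i * V * ((1 - x) ^ n)⁻¹ ≤ q * Real.exp (n * (x / (1 - x))) := by
    have := inv_one_sub_pow_le_exp hx0 (by linarith : x < 1) (le_refl n)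
    have hq0 : 0 ≤ q := (mul_nonneg hp0 hV).trans hq
    gcongr
  rw [h2]
  linarith

lemma tendsto_log_sq_mul_rpow_neg {s : ℝ} (hs : 0 < s) :
    Tendsto (fun n : ℕ => Real.log n ^ 2 * (n : ℝ) ^ (-s)) atTop (nhds 0) := by
  have h := ((isLittleO_log_rpow_rpow_atTop 2 hs).tendsto_div_nhds_zero).comp
    tendsto_natCast_atTop_atTop
  refine h.congr fun n => ?_
  simp only [Function.comp]
  rw [Real.rpow_neg (Nat.cast_nonneg n), div_eq_mul_inv]
  norm_num

lemma tendsto_log_div : Tendsto (fun n : ℕ => Real.log n / n) atTop (nhds 0) :=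
  (Real.isLittleO_log_id_atTop.tendsto_div_nhds_zero).comp tendsto_natCast_atTop_atTop

lemma tendsto_zero_of_log_scaling {c : ℝ} {x cn : ℕ → ℝ} (hcn : Tendsto cn atTop (nhds c))
    (hx : ∀ᶠ n : ℕ in atTop, x n = cn n * Real.log n / n) : Tendsto x atTop (nhds 0) := by
  have h := hcn.mul tendsto_log_div
  rw [mul_zero] at h
  refine h.congr' ?_
  filter_upwards [hx] with n hn
  rw [hn, mul_div_assoc]

/-- The upper bound in the second moment method vanishes in the limit. -/
lemma tendsto_second_moment_bound {c ε : ℝ} (hc1 : c < 1) (hε : 0 < ε) {x cn δ q : ℕ → ℝ}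
    (hcn : Tendsto cn atTop (nhds c)) (hx : ∀ᶠ n : ℕ in atTop, x n = cn n * Real.log n / n)
    (hδ : Tendsto (fun n : ℕ => n * δ n) atTop (nhds 0))
    (hq0 : ∀ᶠ n in atTop, 0 ≤ q n)
    (hq : Tendsto (fun n : ℕ => q n * (n : ℝ) ^ ((1 + c) / 2)) atTop (nhds 0)) :
    Tendsto (fun n : ℕ => ENNReal.ofReal
      (Real.exp (n * (x n / (1 - x n))) / (n * ε) + ((1 - x n) ^ 2)⁻¹ * Real.exp (4 * (n * δ n))
        + q n * Real.exp (n * (x n / (1 - x n))) - 1)) atTop (nhds 0) := by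
  have hx0 := tendsto_zero_of_log_scaling hcn hx
  have hexp : ∀ᶠ n : ℕ in atTop, Real.exp (n * (x n / (1 - x n))) ≤ (n : ℝ) ^ ((1 + c) / 2) := by
    have hlim : Tendsto (fun n => cn n / (1 - x n)) atTop (nhds c) := by
      have h := hcn.div (hx0.const_sub 1) (by norm_num)
      rw [sub_zero, div_one] at h
      exact h
    filter_upwards [hx, hlim.eventually_le_const (by linarith : c < (1 + c) / 2),
      eventually_ge_atTop 1] with n hn hle hn1
    have hn0 : (0 : ℝ) < n := by exact_mod_cast hn1
    rw [Real.rpow_def_of_pos hn0, Real.exp_le_exp]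
    have hlog : 0 ≤ Real.log n := Real.log_nonneg (by exact_mod_cast hn1)
    calc n * (x n / (1 - x n)) = Real.log n * (cn n / (1 - x n)) := by
          rw [← mul_div_assoc, ← mul_div_assoc]
          congr 1
          rw [hn]
          field_simp
      _ ≤ Real.log n * ((1 + c) / 2) := by gcongr
  have hfirst : Tendsto (fun n : ℕ => (n : ℝ) ^ ((1 + c) / 2) / (n * ε)) atTop (nhds 0) := by
    have h := ((tendsto_rpow_neg_atTop (by linarith : 0 < (1 - c) / 2)).comp
      tendsto_natCast_atTop_atTop).div_const ε
    rw [zero_div] at h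
    refine h.congr' ?_
    filter_upwards [eventually_ge_atTop 1] with n hn1
    have hn0 : (0 : ℝ) < n := by exact_mod_cast hn1
    simp only [Function.comp]
    rw [← div_div, show -((1 - c) / 2) = (1 + c) / 2 - 1 by ring, Real.rpow_sub_one hn0.ne']
  have hsecond : Tendsto (fun n : ℕ => ((1 - x n) ^ 2)⁻¹ * Real.exp (4 * (n * δ n))) atTop
      (nhds 1) := by
    have h := (((hx0.const_sub 1).pow 2).inv₀ (by norm_num)).mul
      (Real.continuous_exp.continuousAt.tendsto.comp (hδ.const_mul 4))
    simpa [Function.comp_def] using h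
  have hsum := ((hfirst.add hsecond).add hq).sub_const 1
  rw [show (0 : ℝ) + 1 + 0 - 1 = 0 by norm_num] at hsum
  have hofReal := ENNReal.tendsto_ofReal hsum
  rw [ENNReal.ofReal_zero] at hofReal
  refine tendsto_of_tendsto_of_tendsto_of_le_of_le' tendsto_const_nhds hofReal
    (Eventually.of_forall fun _ => zero_le) ?_
  filter_upwards [hexp, hq0] with n hn hqn
  apply ENNReal.ofReal_le_ofReal
  gcongr

/-- The zero-law, given suitable bounds on the pair correlations. -/
lemma tendsto_measure_no_isolated {r : ℕ} {μ : Fin r → ℝ}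
    (hμpos : ∀ i, 0 < μ i) (hμsum : ∑ i, μ i = 1)
    {Pn : ℕ → ℕ} {Kn : ℕ → Fin r → ℕ} (hKP : ∀ n i, 2 * Kn n i ≤ Pn n)
    {αn : ℕ → Fin r → Fin r → ℝ}
    (hα0 : ∀ n i j, 0 < αn n i j) (hα1 : ∀ n i j, αn n i j < 1)
    (hαsymm : ∀ n i j, αn n i j = αn n j i)
    {c : ℝ} (hc1 : c < 1) {cn : ℕ → ℝ} (hcn : Tendsto cn atTop (nhds c))
    {m : ℕ → Fin r} {x : ℕ → ℝ} (hxm : ∀ n, LamE μ (αn n) (Pn n) (Kn n) (m n) = x n)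
    (hx : ∀ᶠ n : ℕ in atTop, x n = cn n * Real.log n / n)
    {Ω : ℕ → Type} [∀ n, MeasurableSpace (Ω n)] {Pr : ∀ n, Measure (Ω n)}
    (M : ∀ n, HetModel r n (Pn n) (Kn n) μ (αn n) (Ω n) (Pr n))
    {δ q : ℕ → ℝ} {V : ℝ} (hV : 0 ≤ V) (hδ0 : ∀ n, 0 ≤ δ n)
    (hδ : Tendsto (fun n : ℕ => n * δ n) atTop (nhds 0))
    (hpq : ∀ᶠ n in atTop, pEdge (Pn n) (Kn n) (m n) (m n) * V ≤ q n)
    (hq : Tendsto (fun n : ℕ => q n * (n : ℝ) ^ ((1 + c) / 2)) atTop (nhds 0))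
    (hJ : ∀ n, ∀ T T' : Finset (Fin (Pn n)), T.card = Kn n (m n) → T'.card = Kn n (m n) →
      (∑ b, stateProb (Pn n) (Kn n) μ b *
        (nonadjProb (αn n) (m n, T) b * nonadjProb (αn n) (m n, T') b)) ^ (n - 2)
        ≤ (1 - 2 * x n + δ n) ^ (n - 2) + meets T T' * (V * (1 - x n) ^ (n - 2))) :
    Tendsto (fun n => Pr n {ω | ∀ x : Fin n, ¬ (M n).Isolated ω x})
      atTop (nhds (0 : ENNReal)) := by
  have : Nonempty (Fin r) := ⟨m 0⟩
  obtain ⟨i₀, hi₀⟩ := Finite.exists_min μ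
  have hq0 : ∀ᶠ n in atTop, 0 ≤ q n :=
    hpq.mono fun n hn => (mul_nonneg (pEdge_nonneg (hKP n) _ _) hV).trans hn
  refine tendsto_of_tendsto_of_tendsto_of_le_of_le' tendsto_const_nhds
    (tendsto_second_moment_bound hc1 (hμpos i₀) hcn hx hδ hq0 hq)
    (Eventually.of_forall fun _ => zero_le) ?_
  have hx0 := tendsto_zero_of_log_scaling hcn hx
  filter_upwards [hpq, eventually_ge_atTop 2, hx0.eventually_le_const (by norm_num : (0 : ℝ) < 1 / 2)]
    with n hpn hn hxn
  exact (M n).measure_no_isolated_le_exp hn (hKP n) hμsum hμpos (hαsymm n) (hα0 n) (hα1 n) (hxm n)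
    hxn (hδ0 n) hV hpn (hμpos i₀) (hi₀ _) (hJ n)

/-- zero-law for absence of isolated nodes.
Under any scaling with `Λ_m(n) = c_n log n / n`, `c_n → c ∈ (0,1)`, and with
either (a) `α_{md}(n) log n → 0`, or (b) `α_{md}(n) log n → α* ∈ (0,∞]` and
`α_{mm}(n) log n → α** ∈ (0,∞]` (limits in `[0,∞]`), the probability that
`H(n; μ, Θ_n)` has no isolated nodes tends to `0`. -/
theorem no_isolated_nodes_zero_law
    (hr : 0 < r)
    (hμpos : ∀ i, 0 < μ i) (hμsum : ∑ i, μ i = 1)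
    (Pn : ℕ → ℕ) (Kn : ℕ → Fin r → ℕ)
    (hKpos : ∀ n i, 1 ≤ Kn n i)
    (hKmono : ∀ n, Monotone (Kn n))
    (hKP : ∀ n i, 2 * Kn n i ≤ Pn n)
    (αn : ℕ → Fin r → Fin r → ℝ)
    (hα0 : ∀ n i j, 0 < αn n i j) (hα1 : ∀ n i j, αn n i j < 1)
    (hαsymm : ∀ n i j, αn n i j = αn n j i)
    (c : ℝ) (hc0 : 0 < c) (hc1 : c < 1) (cn : ℕ → ℝ)
    (hcn : Tendsto cn atTop (nhds c))
    (hscal : ∀ n, 2 ≤ n →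
      LamMin μ (αn n) (Pn n) (Kn n) = cn n * Real.log n / n)
    -- `m n` is an index attaining the minimum mean edge probability `Λ_m(n)`
    (m : ℕ → Fin r)
    (hm : ∀ n i, LamE μ (αn n) (Pn n) (Kn n) (m n) ≤ LamE μ (αn n) (Pn n) (Kn n) i)
    -- condition (a) or condition (b), with `α_{md}(n) = max_j α_{m(n) j}(n)`
    -- and `α_{mm}(n) = α_{m(n) m(n)}(n)`, limits taken in `[0,∞]`
    (hcond :
      (Tendsto (fun n => ENNReal.ofReal ((⨆ j, αn n (m n) j) * Real.log n))
          atTop (nhds 0)) ∨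
      (∃ αstar αstarstar : ENNReal, αstar ≠ 0 ∧ αstarstar ≠ 0 ∧
        Tendsto (fun n => ENNReal.ofReal ((⨆ j, αn n (m n) j) * Real.log n))
          atTop (nhds αstar) ∧
        Tendsto (fun n => ENNReal.ofReal (αn n (m n) (m n) * Real.log n))
          atTop (nhds αstarstar)))
    (Ω : ℕ → Type) [mΩ : ∀ n, MeasurableSpace (Ω n)]
    (Pr : ∀ n, Measure (Ω n)) (hPr : ∀ n, IsProbabilityMeasure (Pr n))
    (M : ∀ n, HetModel r n (Pn n) (Kn n) μ (αn n) (Ω n) (Pr n)) :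
    Tendsto (fun n => Pr n {ω | ∀ x : Fin n, ¬ (M n).Isolated ω x})
      atTop (nhds (0 : ENNReal)) := by
  have : Nonempty (Fin r) := ⟨⟨0, hr⟩⟩
  set x : ℕ → ℝ := fun n => LamE μ (αn n) (Pn n) (Kn n) (m n) with hxdef
  have hx : ∀ᶠ n : ℕ in atTop, x n = cn n * Real.log n / n := by
    filter_upwards [eventually_ge_atTop 2] with n hn
    rw [← hscal n hn]
    exact le_antisymm (le_ciInf (hm n)) (ciInf_le (Set.finite_range _).bddBelow (m n))
  have hx0 : ∀ n, 0 ≤ x n := fun n => LamE_nonneg (hKP n) hμpos (hα0 n) _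
  have hJ0 : ∀ n (T T' : Finset (Fin (Pn n))), 0 ≤ ∑ b, stateProb (Pn n) (Kn n) μ b *
      (nonadjProb (αn n) (m n, T) b * nonadjProb (αn n) (m n, T') b) := fun n T T' =>
    sum_nonneg fun b _ => mul_nonneg (stateProb_nonneg hμpos b)
      (mul_nonneg (nonadjProb_nonneg (hα1 n) _ _) (nonadjProb_nonneg (hα1 n) _ _))
  have hlogsq : Tendsto (fun n : ℕ => Real.log n ^ 2 / n) atTop (nhds 0) := by
    refine (tendsto_log_sq_mul_rpow_neg one_pos).congr fun n => ?_
    rw [Real.rpow_neg_one, div_eq_mul_inv]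
  rcases hcond with ha | ⟨-, β, -, hβ, -, hb⟩
  · set A : ℕ → ℝ := fun n => ⨆ j, αn n (m n) j with hA
    have hAle : ∀ n j, αn n (m n) j ≤ A n := fun n j =>
      le_ciSup (f := αn n (m n)) (Set.finite_range _).bddAbove j
    have hA0 : ∀ n, 0 ≤ A n := fun n => (hα0 n (m n) (m n)).le.trans (hAle n _)
    have hlim : Tendsto (fun n : ℕ => A n * Real.log n) atTop (nhds 0) := by
      refine ((ENNReal.tendsto_toReal ENNReal.zero_ne_top).comp ha).congr fun n => ?_
      exact ENNReal.toReal_ofReal (mul_nonneg (hA0 n) (Real.log_natCast_nonneg n))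
    refine tendsto_measure_no_isolated hμpos hμsum hKP hα0 hα1 hαsymm hc1 hcn (fun _ => rfl) hx M
      (δ := fun n => A n * x n) (q := 0) (V := 0) le_rfl (fun n => mul_nonneg (hA0 n) (hx0 n)) ?_
      (by simp) (by simp) ?_
    · have h := hcn.mul hlim
      rw [mul_zero] at h
      refine h.congr' ?_
      filter_upwards [hx, eventually_ge_atTop 1] with n hn hn1
      have hn0 : (n : ℝ) ≠ 0 := by exact_mod_cast (by omega : n ≠ 0)
      rw [hn]
      field_simp
    · intro n T T' hT hT'
      rw [zero_mul, mul_zero, add_zero]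
      exact pow_le_pow_left₀ (hJ0 n T T') (sum_stateProb_nonadj_mul_le (hKP n) hμsum hμpos (hα0 n)
        (hAle n) hT hT') _
  · obtain ⟨ε, hε0, hεβ⟩ := ENNReal.lt_iff_exists_nnreal_btwn.1 (pos_iff_ne_zero.2 hβ)
    have hε0' : (0 : ℝ) < ε := by exact_mod_cast hε0
    obtain ⟨i₀, hi₀⟩ := Finite.exists_min μ
    have hμ₀ := hμpos i₀
    have hD0 : 0 ≤ ∑ j, (μ j)⁻¹ := sum_nonneg fun j _ => (inv_pos.2 (hμpos j)).le
    refine tendsto_measure_no_isolated hμpos hμsum hKP hα0 hα1 hαsymm hc1 hcn (fun _ => rfl) hx M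
      (δ := fun n => (∑ j, (μ j)⁻¹) * x n ^ 2)
      (q := fun n => cn n * Real.log n ^ 2 / n / (μ i₀ * ε)) (V := 1) zero_le_one
      (fun n => mul_nonneg hD0 (sq_nonneg _)) ?_ ?_ ?_ ?_
    · have h := ((hcn.pow 2).mul hlogsq).const_mul (∑ j, (μ j)⁻¹)
      rw [mul_zero, mul_zero] at h
      refine h.congr' ?_
      filter_upwards [hx, eventually_ge_atTop 1] with n hn hn1
      have hn0 : (n : ℝ) ≠ 0 := by exact_mod_cast (by omega : n ≠ 0)
      rw [hn]
      field_simp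
    · filter_upwards [hx, hb.eventually (lt_mem_nhds hεβ)] with n hn hεn
      have hle : (ε : ℝ) ≤ αn n (m n) (m n) * Real.log n := by
        rw [← ENNReal.ofReal_coe_nnreal] at hεn
        exact ((ENNReal.ofReal_lt_ofReal_iff_of_nonneg hε0'.le).1 hεn).le
      have hp0 := pEdge_nonneg (hKP n) (m n) (m n)
      have hlog := Real.log_natCast_nonneg n
      rw [mul_one, le_div_iff₀ (by positivity)]
      calc pEdge (Pn n) (Kn n) (m n) (m n) * (μ i₀ * ε)
          ≤ pEdge (Pn n) (Kn n) (m n) (m n) *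
              (μ (m n) * (αn n (m n) (m n) * Real.log n)) := by
            have := hi₀ (m n)
            have := (hμpos (m n)).le
            gcongr
        _ = μ (m n) * (αn n (m n) (m n) * pEdge (Pn n) (Kn n) (m n) (m n)) * Real.log n := by ring
        _ ≤ x n * Real.log n := by
            have := mul_pEdge_le_LamE (hKP n) hμpos (hα0 n) (m n) (m n)
            gcongr
        _ = cn n * Real.log n ^ 2 / n := by
            rw [hn]
            ring
    · have h := (hcn.div_const (μ i₀ * ε)).mul
        (tendsto_log_sq_mul_rpow_neg (by linarith : 0 < (1 - c) / 2))
      rw [mul_zero] at h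
      refine h.congr' ?_
      filter_upwards [eventually_ge_atTop 1] with n hn1
      have hn0 : (0 : ℝ) < n := by exact_mod_cast hn1
      rw [show -((1 - c) / 2) = (1 + c) / 2 - 1 by ring, Real.rpow_sub_one hn0.ne']
      ring
    · intro n T T' hT hT'
      have hx1 : 0 ≤ 1 - x n := by
        have h := sum_stateProb_nonadj (α := αn n) (hKP n) hμsum (a := (m n, T)) hT
        rw [hxdef]
        simp only at h ⊢
        rw [← h]
        exact sum_nonneg fun b _ => mul_nonneg (stateProb_nonneg hμpos b)
          (nonadjProb_nonneg (hα1 n) _ _)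
      have hfirst : 0 ≤ (1 - 2 * x n + (∑ j, (μ j)⁻¹) * x n ^ 2) ^ (n - 2) := by
        have hD1 : 1 ≤ ∑ j, (μ j)⁻¹ := by
          have hle : μ i₀ ≤ 1 := hμsum ▸ single_le_sum (fun j _ => (hμpos j).le) (mem_univ i₀)
          exact (one_le_inv₀ hμ₀ |>.2 hle).trans
            (single_le_sum (f := fun j => (μ j)⁻¹) (fun j _ => (inv_pos.2 (hμpos j)).le)
              (mem_univ i₀))
        refine pow_nonneg ?_ _
        nlinarith [sq_nonneg (1 - x n), sq_nonneg (x n)]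
      by_cases hd : T ∩ T' = ∅
      · have h := pow_le_pow_left₀ (hJ0 n T T') (sum_stateProb_nonadj_mul_le_of_disjoint (hKP n)
          hμsum hμpos (hα0 n) hT hT' hd) (n - 2)
        simpa [meets, hd] using h
      · have h := pow_le_pow_left₀ (hJ0 n T T') (sum_stateProb_nonadj_mul_le (hKP n) hμsum hμpos
          (hα0 n) (fun j => (hα1 n (m n) j).le) hT hT') (n - 2)
        rw [meets, if_pos (nonempty_iff_ne_empty.2 hd), one_mul, one_mul]
        refine h.trans ((le_of_eq ?_).trans (le_add_of_nonneg_left hfirst))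
        congr 1
        ring
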